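/- Let n > 0 be real, τ ≥ 1, and μ₀ = ∫ (x² − τ/n)_+ dN(0, 1/n)(x). Then for every θ ∈ ℝ, the bias of the thresholding estimator Q̂(x) = (x² − τ/n)_+ − μ₀ at θ satisfies |∫ (x² − τ/n)_+ dN(θ, 1/n)(x) − μ₀ − θ²| ≤ min(2τ/n, θ²). -/

import Mathlib

open MeasureTheory ProbabilityTheory Real
open scoped NNReal ENNReal

/-- The second moment of a real Gaussian distribution. -/
lemma integral_sq_gaussianReal (μ : ℝ) (v : ℝ≥0) :
    ∫ x, x ^ 2 ∂(gaussianReal μ v) = v + μ ^ 2 := by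
  have h := variance_eq_sub (memLp_id_gaussianReal (μ := μ) (v := v) 2)
  rw [variance_id_gaussianReal] at h
  simp only [Pi.pow_apply, id_eq, integral_id_gaussianReal] at h
  linarith

lemma integrable_sq_gaussianReal (μ : ℝ) (v : ℝ≥0) :
    Integrable (fun x : ℝ ↦ x ^ 2) (gaussianReal μ v) :=
  (memLp_id_gaussianReal (μ := μ) (v := v) 2).integrable_sq

lemma integrable_min_sq_gaussianReal (μ : ℝ) (v : ℝ≥0) (t : ℝ) :
    Integrable (fun x : ℝ ↦ min (x ^ 2) t) (gaussianReal μ v) :=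
  (integrable_sq_gaussianReal μ v).inf (integrable_const t)

lemma integrable_max_sq_sub_gaussianReal (μ : ℝ) (v : ℝ≥0) (t : ℝ) :
    Integrable (fun x : ℝ ↦ max (x ^ 2 - t) 0) (gaussianReal μ v) :=
  ((integrable_sq_gaussianReal μ v).sub (integrable_const t)).sup (integrable_const 0)

lemma integral_max_sq_sub_gaussianReal (μ : ℝ) (v : ℝ≥0) (t : ℝ) :
    ∫ x, max (x ^ 2 - t) 0 ∂(gaussianReal μ v)
      = v + μ ^ 2 - ∫ x, min (x ^ 2) t ∂(gaussianReal μ v) := by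
  rw [← integral_sq_gaussianReal,
    ← integral_sub (integrable_sq_gaussianReal μ v) (integrable_min_sq_gaussianReal μ v t)]
  refine integral_congr_ae (.of_forall fun x ↦ ?_)
  rcases le_total (x ^ 2) t with h | h
  · simp [h]
  · simp [h]

/-- A Gaussian density centred at `θ` dominates the one centred at `0` at points closer to `θ`. -/
lemma gaussianPDFReal_zero_le_of_sq_le {v : ℝ≥0} {θ x : ℝ} (h : (θ - x) ^ 2 ≤ x ^ 2) :
    gaussianPDFReal 0 v x ≤ gaussianPDFReal θ v x := by
  unfold gaussianPDFReal
  refine mul_le_mul_of_nonneg_left (exp_le_exp.2 (div_le_div_of_nonneg_right ?_ (by positivity)))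
    (by positivity)
  nlinarith

lemma gaussianPDFReal_le_zero_of_sq_le {v : ℝ≥0} {θ x : ℝ} (h : x ^ 2 ≤ (θ - x) ^ 2) :
    gaussianPDFReal θ v x ≤ gaussianPDFReal 0 v x := by
  unfold gaussianPDFReal
  refine mul_le_mul_of_nonneg_left (exp_le_exp.2 (div_le_div_of_nonneg_right ?_ (by positivity)))
    (by positivity)
  nlinarith

lemma integral_comp_const_sub_gaussianReal (μ θ : ℝ) (v : ℝ≥0) {f : ℝ → ℝ} (hf : Continuous f) :
    ∫ x, f (θ - x) ∂(gaussianReal μ v) = ∫ x, f x ∂(gaussianReal (θ - μ) v) := by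
  rw [← gaussianReal_map_const_sub θ,
    integral_map (by fun_prop) hf.aestronglyMeasurable]

lemma integrable_comp_const_sub_gaussianReal (μ θ : ℝ) (v : ℝ≥0) {f : ℝ → ℝ} (hf : Continuous f)
    (hi : Integrable f (gaussianReal (θ - μ) v)) :
    Integrable (fun x ↦ f (θ - x)) (gaussianReal μ v) := by
  rwa [← gaussianReal_map_const_sub θ,
    integrable_map_measure hf.aestronglyMeasurable (by fun_prop)] at hi

/-- Moving the centre of a Gaussian away from `0` increases the mean of `min (x ^ 2) t`. -/
lemma integral_min_sq_gaussianReal_zero_le (θ t : ℝ) {v : ℝ≥0} (hv : v ≠ 0) :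
    ∫ x, min (x ^ 2) t ∂(gaussianReal 0 v) ≤ ∫ x, min (x ^ 2) t ∂(gaussianReal θ v) := by
  have hc : Continuous fun x : ℝ ↦ min (x ^ 2) t := by fun_prop
  have h0 := integral_comp_const_sub_gaussianReal 0 θ v hc
  have hθ := integral_comp_const_sub_gaussianReal θ θ v hc
  rw [sub_zero] at h0
  rw [sub_self] at hθ
  have hi (μ : ℝ) : Integrable (fun x : ℝ ↦ min ((θ - x) ^ 2) t) (gaussianReal μ v) :=
    integrable_comp_const_sub_gaussianReal μ θ v hc (integrable_min_sq_gaussianReal _ v t)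
  have hd (μ : ℝ) : Integrable (fun x : ℝ ↦ min (x ^ 2) t - min ((θ - x) ^ 2) t)
      (gaussianReal μ v) := (integrable_min_sq_gaussianReal μ v t).sub (hi μ)
  have hp (μ : ℝ) : Integrable (fun x : ℝ ↦ gaussianPDFReal μ v x *
      (min (x ^ 2) t - min ((θ - x) ^ 2) t)) := by
    have h := hd μ
    rw [gaussianReal_of_var_ne_zero μ hv, integrable_withDensity_iff_integrable_smul'
      (measurable_gaussianPDF μ v) (.of_forall fun _ ↦ gaussianPDF_lt_top)] at h
    simpa [toReal_gaussianPDF] using h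
  have key : ∫ x, (min (x ^ 2) t - min ((θ - x) ^ 2) t) ∂(gaussianReal 0 v)
      ≤ ∫ x, (min (x ^ 2) t - min ((θ - x) ^ 2) t) ∂(gaussianReal θ v) := by
    simp only [integral_gaussianReal_eq_integral_smul hv, smul_eq_mul]
    refine integral_mono (hp 0) (hp θ) fun x ↦ ?_
    rcases le_total (x ^ 2) ((θ - x) ^ 2) with h | h
    · exact mul_le_mul_of_nonpos_right (gaussianPDFReal_le_zero_of_sq_le h)
        (sub_nonpos.2 (min_le_min_right t h))
    · exact mul_le_mul_of_nonneg_right (gaussianPDFReal_zero_le_of_sq_le h)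
        (sub_nonneg.2 (min_le_min_right t h))
  rw [integral_sub (integrable_min_sq_gaussianReal 0 v t) (hi 0),
    integral_sub (integrable_min_sq_gaussianReal θ v t) (hi θ), h0, hθ] at key
  linarith

/-- Moving the centre of a Gaussian away from `0` increases the mean of the even convex function
`max (x ^ 2 - t) 0`. -/
lemma integral_max_sq_sub_gaussianReal_zero_le (θ t : ℝ) (v : ℝ≥0) :
    ∫ x, max (x ^ 2 - t) 0 ∂(gaussianReal 0 v)
      ≤ ∫ x, max (x ^ 2 - t) 0 ∂(gaussianReal θ v) := by
  have hc : Continuous fun x : ℝ ↦ max (x ^ 2 - t) 0 := by fun_prop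
  have hm := integral_comp_const_sub_gaussianReal 0 θ v hc
  have hs := integral_comp_const_sub_gaussianReal 0 (-θ) v hc
  have hn := integral_comp_const_sub_gaussianReal θ 0 v hc
  simp only [sub_zero, zero_sub, neg_sq] at hm hs hn
  have hi (a : ℝ) : Integrable (fun x : ℝ ↦ max ((a - x) ^ 2 - t) 0) (gaussianReal 0 v) :=
    integrable_comp_const_sub_gaussianReal 0 a v hc (integrable_max_sq_sub_gaussianReal _ v t)
  have key : ∫ x, 2 * max (x ^ 2 - t) 0 ∂(gaussianReal 0 v)
      ≤ ∫ x, (max ((θ - x) ^ 2 - t) 0 + max ((-θ - x) ^ 2 - t) 0) ∂(gaussianReal 0 v) := by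
    refine integral_mono ((integrable_max_sq_sub_gaussianReal 0 v t).const_mul 2)
      ((hi θ).add (hi (-θ))) fun x ↦ ?_
    have h1 := le_max_left ((θ - x) ^ 2 - t) 0
    have h2 := le_max_right ((θ - x) ^ 2 - t) 0
    have h3 := le_max_left ((-θ - x) ^ 2 - t) 0
    have h4 := le_max_right ((-θ - x) ^ 2 - t) 0
    change 2 * max (x ^ 2 - t) 0 ≤ max ((θ - x) ^ 2 - t) 0 + max ((-θ - x) ^ 2 - t) 0
    rcases max_cases (x ^ 2 - t) 0 with ⟨h, _⟩ | ⟨h, _⟩ <;> rw [h] <;> nlinarith [sq_nonneg θ]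
  rw [integral_const_mul, integral_add (hi θ) (hi (-θ)), hm, hs, ← hn] at key
  linarith

lemma integral_min_sq_gaussianReal_mem_Icc (μ : ℝ) (v : ℝ≥0) {t : ℝ} (ht : 0 ≤ t) :
    ∫ x, min (x ^ 2) t ∂(gaussianReal μ v) ∈ Set.Icc 0 t := by
  refine ⟨integral_nonneg fun x ↦ le_min (sq_nonneg x) ht, ?_⟩
  simpa using integral_mono (integrable_min_sq_gaussianReal μ v t)
    (integrable_const (μ := gaussianReal μ v) t) fun x ↦ min_le_right (x ^ 2) t

/-- bias bound for the thresholding estimator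
`Q̂(x) = (x² - τ/n)₊ - μ₀` at θ: `|E_θ Q̂ - θ²| ≤ min(2τ/n, θ²)`. -/
theorem abs_bias_thresholding_le (n τ : ℝ) (hn : 0 < n) (hτ : 1 ≤ τ) (θ : ℝ) :
    |(∫ x, max (x ^ 2 - τ / n) 0 ∂(gaussianReal θ (Real.toNNReal (1 / n))))
        - (∫ x, max (x ^ 2 - τ / n) 0 ∂(gaussianReal 0 (Real.toNNReal (1 / n))))
        - θ ^ 2| ≤
      min (2 * τ / n) (θ ^ 2) := by
  have hv : Real.toNNReal (1 / n) ≠ 0 := (Real.toNNReal_pos.2 (by positivity)).ne'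
  have ht : 0 ≤ τ / n := by positivity
  have h2 : 2 * τ / n = 2 * (τ / n) := by ring
  have hmin := integral_min_sq_gaussianReal_zero_le θ (τ / n) hv
  have hmax := integral_max_sq_sub_gaussianReal_zero_le θ (τ / n) (Real.toNNReal (1 / n))
  have e0 := integral_max_sq_sub_gaussianReal 0 (Real.toNNReal (1 / n)) (τ / n)
  have eθ := integral_max_sq_sub_gaussianReal θ (Real.toNNReal (1 / n)) (τ / n)
  obtain ⟨l0, -⟩ := integral_min_sq_gaussianReal_mem_Icc 0 (Real.toNNReal (1 / n)) ht
  obtain ⟨-, uθ⟩ := integral_min_sq_gaussianReal_mem_Icc θ (Real.toNNReal (1 / n)) ht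
  rw [h2, abs_le]
  constructor
  · rw [neg_le]
    refine le_min ?_ ?_ <;> linarith
  · refine le_min ?_ ?_ <;> nlinarith [sq_nonneg θ]
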